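/- There exists a universal constant γ₊ > 0 such that for all functions h, w : ℤ⁺ → ℤ⁺ with √h ≻ 1 and w ≻ √h, one has L[h, w] ∼ γ₊·w·√h; that is, L[h(n), w(n)] / (γ₊·w(n)·√(h(n))) → 1 as n → ∞. -/

import Mathlib

open Filter

/-- A Kostant picture of height `η`. -/
def IsKostant {w : ℕ} (η : Fin w → ℕ) (c : Fin w → Fin w → ℕ) : Prop :=
  (∀ i j : Fin w, j < i → c i j = 0) ∧
  ∀ m : Fin w, (∑ i : Fin w, ∑ j : Fin w, (if i ≤ m ∧ m ≤ j then c i j else 0)) = η m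

/-- Kostant's partition function. -/
noncomputable def KPF {w : ℕ} (η : Fin w → ℕ) : ℕ :=
  Set.ncard {c : Fin w → Fin w → ℕ | IsKostant η c}

/-- `L[h,w] = ln KPF[(h,…,h)]` for the constant tuple of length `w`. -/
noncomputable def Lbox (h w : ℕ) : ℝ := Real.log (KPF (fun _ : Fin w => h))

lemma IsKostant.le {w : ℕ} {η : Fin w → ℕ} {c : Fin w → Fin w → ℕ} (hc : IsKostant η c)
    (i j : Fin w) : c i j ≤ η i := by
  rcases lt_or_ge j i with h | h
  · simp [hc.1 i j h]
  · rw [← hc.2 i]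
    calc c i j = if i ≤ i ∧ i ≤ j then c i j else 0 := by simp [h]
      _ ≤ ∑ j : Fin w, if i ≤ i ∧ i ≤ j then c i j else 0 :=
        Finset.single_le_sum (f := fun j => if i ≤ i ∧ i ≤ j then c i j else 0)
          (fun _ _ => Nat.zero_le _) (Finset.mem_univ j)
      _ ≤ _ := Finset.single_le_sum
          (f := fun k => ∑ j : Fin w, if k ≤ i ∧ i ≤ j then c k j else 0)
          (fun _ _ => Nat.zero_le _) (Finset.mem_univ i)

/-- A finite box containing all Kostant pictures of height `η`. -/
def kostantBox {w : ℕ} (η : Fin w → ℕ) : Finset (Fin w → Fin w → ℕ) :=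
  Fintype.piFinset fun i => Fintype.piFinset fun j =>
    if j < i then {0} else Finset.range (η i + 1)

lemma IsKostant.mem_box {w : ℕ} {η : Fin w → ℕ} {c : Fin w → Fin w → ℕ} (hc : IsKostant η c) :
    c ∈ kostantBox η := by
  simp only [kostantBox, Fintype.mem_piFinset]
  intro i j
  split_ifs with h
  · simpa using hc.1 i j h
  · simpa [Nat.lt_succ_iff] using hc.le i j

lemma finite_setOf_isKostant {w : ℕ} (η : Fin w → ℕ) : {c | IsKostant η c}.Finite :=
  (kostantBox η).finite_toSet.subset fun _ hc => hc.mem_box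

lemma sum_length_mul_eq {w h : ℕ} {c : Fin w → Fin w → ℕ} (hc : IsKostant (fun _ => h) c) :
    ∑ i, ∑ j, (Finset.Icc i j).card * c i j = w * h := by
  have h1 : ∑ m : Fin w, ∑ i : Fin w, ∑ j : Fin w, (if i ≤ m ∧ m ≤ j then c i j else 0)
      = w * h := by
    rw [Finset.sum_congr rfl fun m _ => hc.2 m]
    simp
  rw [← h1]
  symm
  rw [Finset.sum_comm]
  refine Finset.sum_congr rfl fun i _ => ?_
  rw [Finset.sum_comm]
  refine Finset.sum_congr rfl fun j _ => ?_
  rw [← Finset.sum_filter, Finset.sum_const, smul_eq_mul]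
  congr 2
  ext m
  simp

/-- The generating function bound on the number of Kostant pictures. -/
lemma KPF_mul_pow_le (h w : ℕ) {x : ℝ} (hx0 : 0 < x) (hx1 : x < 1) :
    (KPF (fun _ : Fin w => h) : ℝ) * x ^ (w * h) ≤
      ∏ i : Fin w, ∏ j : Fin w, if j < i then 1 else (1 - x ^ (Finset.Icc i j).card)⁻¹ := by
  classical
  have hfin := finite_setOf_isKostant (fun _ : Fin w => h)
  have hK : KPF (fun _ : Fin w => h) = hfin.toFinset.card := by
    rw [KPF, Set.ncard_eq_toFinset_card _ hfin]
  have hw : ∀ c ∈ hfin.toFinset, ∏ i, ∏ j, x ^ ((Finset.Icc i j).card * c i j) = x ^ (w * h) := by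
    intro c hc
    rw [← sum_length_mul_eq ((Set.Finite.mem_toFinset hfin).1 hc)]
    simp only [Finset.prod_pow_eq_pow_sum]
  rw [hK, ← nsmul_eq_mul, ← Finset.sum_const, ← Finset.sum_congr rfl hw]
  calc _ ≤ ∑ c ∈ kostantBox (fun _ : Fin w => h),
        ∏ i, ∏ j, x ^ ((Finset.Icc i j).card * c i j) := by
        refine Finset.sum_le_sum_of_subset_of_nonneg (fun c hc => ?_) fun _ _ _ => by positivity
        exact ((Set.Finite.mem_toFinset hfin).1 hc).mem_box
    _ = ∏ i : Fin w, ∏ j : Fin w, ∑ k ∈ (if j < i then {0} else Finset.range (h + 1)),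
        x ^ ((Finset.Icc i j).card * k) := by
        rw [kostantBox, ← Finset.prod_univ_sum _ (fun i (c : Fin w → ℕ) =>
          ∏ j, x ^ ((Finset.Icc i j).card * c j))]
        refine Finset.prod_congr rfl fun i _ => ?_
        rw [← Finset.prod_univ_sum _ (fun j (k : ℕ) => x ^ ((Finset.Icc i j).card * k))]
    _ ≤ _ := by
        refine Finset.prod_le_prod (fun i _ => Finset.prod_nonneg fun j _ =>
          Finset.sum_nonneg fun _ _ => by positivity) fun i _ =>
          Finset.prod_le_prod (fun j _ => Finset.sum_nonneg fun _ _ => by positivity) fun j _ => ?_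
        split_ifs with hij
        · simp
        · have hne : (Finset.Icc i j).card ≠ 0 := by
            rw [Ne, Finset.card_eq_zero, Finset.Icc_eq_empty_iff]
            exact not_not.2 (not_lt.1 hij)
          simp only [pow_mul]
          exact sum_le_hasSum _ (fun _ _ => by positivity)
            (hasSum_geometric_of_lt_one (by positivity) (pow_lt_one₀ hx0.le hx1 hne))

/-- Attaching to each of the first `n` positions a family of intervals taken from `T`, and
filling up with one-point intervals, yields at least `T.card ^ n` Kostant pictures. -/
lemma card_pow_le_KPF {D : Type*} [Fintype D] [DecidableEq D] (ℓ : D → ℕ)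
    (hℓ : Function.Injective ℓ)
    (T : Finset (D → ℕ)) (b h : ℕ) (hpos : ∀ x, 0 < ℓ x) (hb : ∀ x, ℓ x ≤ b) (u : ℕ → ℕ)
    (hT : ∀ t ∈ T, ∀ e, ∑ x, (if e ≤ ℓ x then t x else 0) ≤ u e)
    (hu : ∑ e ∈ Finset.range (b + 1), u e ≤ h) {n w : ℕ} (hnw : n + b ≤ w) :
    T.card ^ n ≤ KPF (fun _ : Fin w => h) := by
  classical
  let P : Finset (Fin w → D → ℕ) :=
    Fintype.piFinset fun i => if (i : ℕ) < n then T else {0}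
  have hP : P.card = T.card ^ n := by
    have hn : n ≤ w := by omega
    rw [Fintype.card_piFinset]
    have : ∀ i : Fin w, (if (i : ℕ) < n then T else {0}).card
        = if (i : ℕ) < n then T.card else 1 := by
      intro i; split_ifs <;> simp
    rw [Finset.prod_congr rfl fun i _ => this i,
      Fin.prod_univ_eq_prod_range (fun i => if i < n then T.card else 1) w,
      ← Finset.prod_filter, Finset.prod_const]
    congr 1
    rw [show (Finset.range w).filter (· < n) = Finset.range n by ext; simp; omega]
    simp
  let ht : (Fin w → D → ℕ) → Fin w → ℕ := fun G m =>
    ∑ i : Fin w, ∑ x, if (i : ℕ) ≤ m ∧ (m : ℕ) ≤ i + ℓ x then G i x else 0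
  let pic : (Fin w → D → ℕ) → Fin w → Fin w → ℕ := fun G i k =>
    (if i = k then h - ht G i else 0) + ∑ x, if (k : ℕ) = i + ℓ x then G i x else 0
  have hsupp : ∀ G ∈ P, ∀ i x, G i x ≠ 0 → (i : ℕ) + ℓ x < w := by
    intro G hG i x hne
    have hi := Fintype.mem_piFinset.1 hG i
    have := hb x
    split_ifs at hi with h1
    · omega
    · simp at hi; simp [hi] at hne
  have hht : ∀ G ∈ P, ∀ m, ht G m ≤ h := by
    intro G hG m
    refine le_trans ?_ hu
    have h1 : ∀ i : Fin w, (∑ x, if (i : ℕ) ≤ m ∧ (m : ℕ) ≤ i + ℓ x then G i x else 0)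
        ≤ if (i : ℕ) ≤ m ∧ (m : ℕ) ≤ i + b then u (m - i) else 0 := by
      intro i
      split_ifs with hi
      · have hi' := Fintype.mem_piFinset.1 hG i
        split_ifs at hi' with h1
        · refine le_trans (Finset.sum_le_sum fun x _ => ?_) (hT _ hi' (m - i))
          split_ifs <;> omega
        · simp at hi'; simp [hi']
      · refine le_of_eq (Finset.sum_eq_zero fun x _ => ?_)
        have := hb x
        rw [if_neg]; omega
    refine (Finset.sum_le_sum fun i _ => h1 i).trans ?_
    rw [← Finset.sum_filter]
    rw [← Finset.sum_image (f := u) (g := fun i : Fin w => (m : ℕ) - i)]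
    · refine Finset.sum_le_sum_of_subset fun e he => ?_
      simp only [Finset.mem_image, Finset.mem_filter, Finset.mem_univ, true_and] at he
      obtain ⟨i, hi, rfl⟩ := he
      simp; omega
    · intro i hi j hj hij
      simp at hi hj hij
      ext; omega
  have hmaps : ∀ G ∈ P, IsKostant (fun _ => h) (pic G) := by
    intro G hG
    refine ⟨fun i j hij => ?_, fun m => ?_⟩
    · have h1 : ¬ i = j := by rintro rfl; exact lt_irrefl _ hij
      simp only [pic, h1, if_false, zero_add]
      refine Finset.sum_eq_zero fun x _ => ?_
      rw [if_neg]
      have := Fin.lt_def.1 hij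
      omega
    · have key : ∀ i : Fin w, (∑ k : Fin w, if i ≤ m ∧ m ≤ k then pic G i k else 0)
          = (if i = m then h - ht G m else 0)
            + ∑ x, if (i : ℕ) ≤ m ∧ (m : ℕ) ≤ i + ℓ x then G i x else 0 := by
        intro i
        have e1 : ∀ k : Fin w, (if i ≤ m ∧ m ≤ k then pic G i k else 0)
            = (if i = k then (if i = m then h - ht G m else 0) else 0)
              + ∑ x, if (k : ℕ) = i + ℓ x then
                (if (i : ℕ) ≤ m ∧ (m : ℕ) ≤ i + ℓ x then G i x else 0) else 0 := by
          intro k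
          by_cases hc : i ≤ m ∧ m ≤ k
          · rw [if_pos hc]
            simp only [pic]
            congr 1
            · by_cases hik : i = k
              · have him : i = m := le_antisymm hc.1 (hik ▸ hc.2)
                rw [if_pos hik, if_pos hik, if_pos him, him]
              · rw [if_neg hik, if_neg hik]
            · refine Finset.sum_congr rfl fun x _ => ?_
              have h1 := Fin.le_def.1 hc.1
              have h2 := Fin.le_def.1 hc.2
              split_ifs <;> first | rfl | omega
          · rw [if_neg hc]
            symm
            rw [Nat.add_eq_zero_iff]
            constructor
            · split_ifs with h1 h2
              · subst h1; subst h2; simp at hc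
              · rfl
              · rfl
            · refine Finset.sum_eq_zero fun x _ => ?_
              rw [Fin.le_def, Fin.le_def] at hc
              split_ifs <;> first | rfl | omega
        rw [Finset.sum_congr rfl fun k _ => e1 k, Finset.sum_add_distrib, Finset.sum_comm]
        congr 1
        · simp
        · refine Finset.sum_congr rfl fun x _ => ?_
          by_cases hG0 : G i x = 0
          · simp [hG0]
          · have hlt := hsupp G hG i x hG0
            rw [Finset.sum_eq_single (⟨i + ℓ x, hlt⟩ : Fin w)]
            · simp
            · intro k _ hk
              rw [if_neg]
              intro h1; exact hk (Fin.ext h1)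
            · simp
      rw [Finset.sum_congr rfl fun i _ => key i, Finset.sum_add_distrib]
      have := hht G hG m
      simp only [Finset.sum_ite_eq', Finset.mem_univ, if_true]
      change h - ht G m + ht G m = h
      omega
  have hinj : Set.InjOn pic P := by
    have hval : ∀ G ∈ P, ∀ (i : Fin w) (x : D) (hlt : (i : ℕ) + ℓ x < w), pic G i ⟨i + ℓ x, hlt⟩ = G i x := by
      intro G hG i x hlt
      have h1 : ¬ i = ⟨i + ℓ x, hlt⟩ := by
        intro h1
        have := congrArg Fin.val h1
        have := hpos x
        simp at *; omega
      simp only [pic, h1, if_false, zero_add]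
      rw [Finset.sum_eq_single x]
      · simp
      · intro y _ hy
        rw [if_neg]
        intro h2
        exact hy (hℓ (by omega))
      · simp
    intro G hG G' hG' heq
    funext i x
    by_cases hlt : (i : ℕ) + ℓ x < w
    · rw [← hval G hG i x hlt, ← hval G' hG' i x hlt, heq]
    · have h1 := mt (hsupp G hG i x) hlt
      have h2 := mt (hsupp G' hG' i x) hlt
      push Not at h1 h2
      rw [h1, h2]
  rw [← hP, KPF, ← Set.ncard_coe_finset P, ← hinj.ncard_image]
  refine Set.ncard_le_ncard ?_ (finite_setOf_isKostant _)
  rintro _ ⟨G, hG, rfl⟩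
  exact hmaps G hG

lemma card_piAntidiag_univ (α : Type*) [Fintype α] [DecidableEq α] (N : ℕ) :
    (Finset.piAntidiag (Finset.univ : Finset α) N).card = (Fintype.card α).multichoose N := by
  rw [← Finset.map_sym_eq_piAntidiag, Finset.card_map, Finset.sym_univ, Finset.card_univ,
    Sym.card_sym_eq_multichoose]

/-- Lower bound on the number of Kostant pictures obtained by prescribing, in every one of `J`
bands of `s + 1` consecutive lengths, how many intervals start at each position. -/
lemma prod_choose_pow_le_KPF (J s h : ℕ) (N : Fin J → ℕ)
    (hN : ∑ j : Fin J, N j * ((j + 1) * (s + 2)) ≤ h) {n w : ℕ}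
    (hnw : n + J * (s + 1) ≤ w) :
    (∏ j, (s + N j).choose (N j)) ^ n ≤ KPF (fun _ : Fin w => h) := by
  classical
  let T : Finset (Fin J × Fin (s + 1) → ℕ) :=
    (Fintype.piFinset fun j => Finset.piAntidiag Finset.univ (N j)).image
      fun f p => f p.1 p.2
  have hTc : T.card = ∏ j, (s + N j).choose (N j) := by
    rw [Finset.card_image_of_injective, Fintype.card_piFinset]
    · refine Finset.prod_congr rfl fun j _ => ?_
      rw [card_piAntidiag_univ, Nat.multichoose_eq, Fintype.card_fin]
      congr 1; omega
    · intro f g hfg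
      funext j r
      exact congrFun hfg (j, r)
  rw [← hTc]
  have hle : ∀ x : Fin J × Fin (s + 1),
      ((finProdFinEquiv x : Fin (J * (s + 1))) : ℕ) + 1 ≤ (x.1 + 1) * (s + 1) := by
    rintro ⟨j, r⟩
    have := r.2
    simp only [finProdFinEquiv_apply_val]
    nlinarith
  refine card_pow_le_KPF (fun x => ((finProdFinEquiv x : Fin (J * (s + 1))) : ℕ) + 1) ?_ T
    (J * (s + 1)) h (fun x => Nat.succ_pos _) (fun x => (finProdFinEquiv x).2)
    (fun e => ∑ j : Fin J, if e ≤ (j + 1) * (s + 1) then N j else 0) ?_ ?_ hnw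
  · intro x y hxy
    exact finProdFinEquiv.injective (Fin.ext (by simpa using hxy))
  · intro t ht e
    obtain ⟨f, hf, rfl⟩ := Finset.mem_image.1 ht
    rw [Fintype.sum_prod_type]
    refine Finset.sum_le_sum fun j _ => ?_
    have hfj := (Finset.mem_piAntidiag.1 (Fintype.mem_piFinset.1 hf j)).1
    split_ifs with hej
    · rw [← hfj]
      refine Finset.sum_le_sum fun r _ => ?_
      split_ifs <;> simp
    · refine le_of_eq (Finset.sum_eq_zero fun r _ => ?_)
      have := hle (j, r)
      rw [if_neg]
      simp only at this ⊢
      omega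
  · rw [Finset.sum_comm]
    refine le_trans (Finset.sum_le_sum fun j _ => ?_) hN
    rw [← Finset.sum_filter, Finset.sum_const, smul_eq_mul, mul_comm]
    refine Nat.mul_le_mul_left _ ?_
    calc _ ≤ (Finset.range ((j + 1) * (s + 1) + 1)).card := by
          refine Finset.card_le_card fun e he => ?_
          simp at he ⊢; omega
      _ ≤ _ := by
          rw [Finset.card_range]; nlinarith

lemma KPF_pos (h w : ℕ) : 0 < KPF (fun _ : Fin w => h) :=
  prod_choose_pow_le_KPF 0 0 h (fun _ => 0) (by simp) (n := 0) (by simp)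

lemma sum_neg_log_one_sub_exp_pow_le {t Z : ℝ} (ht : 0 < t)
    (hZ : HasSum (fun k : ℕ => 1 / ((k : ℝ) + 1) ^ 2) Z) (w : ℕ) :
    ∑ l ∈ Finset.range w, -Real.log (1 - Real.exp (-t) ^ (l + 1)) ≤ Z / t := by
  have hx0 : 0 < Real.exp (-t) := Real.exp_pos _
  have hx1 : Real.exp (-t) < 1 := Real.exp_zero ▸ Real.exp_lt_exp.2 (by linarith)
  have h1 : ∀ l ∈ Finset.range w, HasSum
      (fun k : ℕ => (Real.exp (-t) ^ (l + 1)) ^ (k + 1) / ((k : ℝ) + 1))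
      (-Real.log (1 - Real.exp (-t) ^ (l + 1))) := fun l _ => by
    refine Real.hasSum_pow_div_log_of_abs_lt_one ?_
    rw [abs_of_pos (by positivity)]
    exact pow_lt_one₀ hx0.le hx1 (by omega)
  refine hasSum_le (fun k => ?_) (hasSum_sum h1) (hZ.div_const t)
  set z := Real.exp (-t) ^ (k + 1) with hz
  have hz0 : 0 < z := by positivity
  have hz1 : z < 1 := pow_lt_one₀ hx0.le hx1 (by omega)
  have hgeo : ∑ l ∈ Finset.range w, z ^ l ≤ (1 - z)⁻¹ :=
    sum_le_hasSum _ (fun _ _ => by positivity) (hasSum_geometric_of_lt_one hz0.le hz1)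
  have hzt : z * (1 - z)⁻¹ ≤ 1 / (((k : ℝ) + 1) * t) := by
    have he : z = (Real.exp (((k : ℝ) + 1) * t))⁻¹ := by
      rw [hz, ← Real.exp_nat_mul, ← Real.exp_neg]
      congr 1; push_cast; ring
    have h2 := Real.add_one_le_exp (((k : ℝ) + 1) * t)
    have hv : 0 < ((k : ℝ) + 1) * t := by positivity
    have h3 : z * (((k : ℝ) + 1) * t + 1) ≤ 1 := by
      rw [he, inv_mul_le_iff₀ (Real.exp_pos _)]; linarith
    rw [← div_eq_mul_inv, div_le_div_iff₀ (by linarith) hv]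
    linarith
  calc ∑ l ∈ Finset.range w, (Real.exp (-t) ^ (l + 1)) ^ (k + 1) / ((k : ℝ) + 1)
      = z * (∑ l ∈ Finset.range w, z ^ l) / ((k : ℝ) + 1) := by
        rw [← Finset.sum_div, Finset.mul_sum]
        congr 1
        refine Finset.sum_congr rfl fun l _ => ?_
        rw [hz]; ring
    _ ≤ 1 / (((k : ℝ) + 1) * t) / ((k : ℝ) + 1) := by
        gcongr
        exact (mul_le_mul_of_nonneg_left hgeo hz0.le).trans hzt
    _ = 1 / ((k : ℝ) + 1) ^ 2 / t := by field_simp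

lemma Lbox_le {Z : ℝ} (hZ0 : 0 < Z) (hZ : HasSum (fun k : ℕ => 1 / ((k : ℝ) + 1) ^ 2) Z)
    {h : ℕ} (hh : 0 < h) (w : ℕ) : Lbox h w ≤ 2 * √Z * w * √(h : ℝ) := by
  have hs : 0 < √(h : ℝ) := Real.sqrt_pos.2 (by exact_mod_cast hh)
  have hsZ : 0 < √Z := Real.sqrt_pos.2 hZ0
  set t := √Z / √(h : ℝ) with ht
  have ht0 : 0 < t := by positivity
  set x := Real.exp (-t) with hx
  have hx0 : 0 < x := Real.exp_pos _
  have hx1 : x < 1 := Real.exp_zero ▸ Real.exp_lt_exp.2 (by linarith)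
  have hpow : ∀ n : ℕ, n ≠ 0 → x ^ n < 1 := fun n hn => pow_lt_one₀ hx0.le hx1 hn
  have hne : ∀ i j : Fin w, ¬ j < i → (Finset.Icc i j).card ≠ 0 := fun i j hij => by
    rw [Ne, Finset.card_eq_zero, Finset.Icc_eq_empty_iff]
    exact not_not.2 (not_lt.1 hij)
  have hfac : ∀ i j : Fin w,
      0 < (if j < i then (1 : ℝ) else (1 - x ^ (Finset.Icc i j).card)⁻¹) := fun i j => by
    split_ifs with hij
    · exact one_pos
    · exact inv_pos.2 (sub_pos.2 (hpow _ (hne i j hij)))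
  have hK : (0 : ℝ) < KPF (fun _ : Fin w => h) := by exact_mod_cast KPF_pos h w
  have key := Real.log_le_log (by positivity) (KPF_mul_pow_le h w hx0 hx1)
  rw [Real.log_mul hK.ne' (by positivity), Real.log_pow, hx, Real.log_exp, ← hx,
    Real.log_prod fun i _ => (Finset.prod_pos fun j _ => hfac i j).ne'] at key
  have hrow : ∀ i : Fin w, Real.log (∏ j : Fin w,
      if j < i then (1 : ℝ) else (1 - x ^ (Finset.Icc i j).card)⁻¹) ≤ Z / t := fun i => by
    rw [Real.log_prod fun j _ => (hfac i j).ne']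
    refine le_trans ?_ (sum_neg_log_one_sub_exp_pow_le ht0 hZ w)
    have e1 : ∀ j : Fin w, Real.log (if j < i then (1 : ℝ) else
        (1 - x ^ (Finset.Icc i j).card)⁻¹)
        = if i ≤ j then -Real.log (1 - x ^ ((j : ℕ) - i + 1)) else 0 := fun j => by
      by_cases hij : j < i
      · rw [if_pos hij, if_neg (not_le.2 hij), Real.log_one]
      · rw [if_neg hij, if_pos (not_lt.1 hij), Real.log_inv, Fin.card_Icc]
        have := Fin.le_def.1 (not_lt.1 hij)
        congr 4; omega
    rw [Finset.sum_congr rfl fun j _ => e1 j, ← Finset.sum_filter,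
      ← Finset.sum_image (f := fun l => -Real.log (1 - x ^ (l + 1)))
        (g := fun j : Fin w => (j : ℕ) - i)]
    · refine Finset.sum_le_sum_of_subset_of_nonneg (fun l hl => ?_) fun l _ _ => ?_
      · simp only [Finset.mem_image, Finset.mem_filter, Finset.mem_univ, true_and] at hl
        obtain ⟨j, hj, rfl⟩ := hl
        simp only [Finset.mem_range]
        omega
      · have := hpow (l + 1) (by omega)
        have h0 : 0 < x ^ (l + 1) := by positivity
        exact neg_nonneg.2 (Real.log_nonpos (by linarith) (by linarith))
    · intro j hj k hk hjk
      simp only [Finset.coe_filter, Finset.mem_univ, true_and, Set.mem_ofPred_eq,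
        Fin.le_def] at hj hk
      simp only at hjk
      ext; omega
  have hsum := Finset.sum_le_sum fun i (_ : i ∈ Finset.univ) => hrow i
  rw [Finset.sum_const, Finset.card_univ, Fintype.card_fin, nsmul_eq_mul] at hsum
  have hfin : Lbox h w ≤ w * (Z / t) + w * h * t := by
    unfold Lbox
    push_cast at key
    linarith
  refine hfin.trans (le_of_eq ?_)
  have e1 : Z / t = √Z * √(h : ℝ) := by
    rw [ht]; field_simp; rw [Real.sq_sqrt hZ0.le]
  have e2 : (h : ℝ) * t = √Z * √(h : ℝ) := by
    rw [ht]; field_simp; rw [Real.sq_sqrt (Nat.cast_nonneg h)]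
  rw [mul_assoc (w : ℝ) (h : ℝ) t, e1, e2]; ring

/-- The largest term of the binomial expansion of `(a + k) ^ (a + k)` is at least the average. -/
lemma add_pow_le_mul_choose (a k : ℕ) :
    (a + k) ^ (a + k) ≤ (a + k + 1) * ((a + k).choose k * k ^ k * a ^ a) := by
  let T : ℕ → ℕ := fun j => k ^ j * a ^ (a + k - j) * (a + k).choose j
  have hsucc : ∀ j, j < a + k → T (j + 1) * ((j + 1) * a) = T j * ((a + k - j) * k) := by
    intro j hj
    have h1 := Nat.choose_succ_right_eq (a + k) j
    have h2 : a ^ (a + k - j) = a ^ (a + k - (j + 1)) * a := by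
      rw [← pow_succ]; congr 1; omega
    simp only [T]
    rw [h2, pow_succ]
    linear_combination (k ^ j * k * a ^ (a + k - (j + 1)) * a) * h1
  have hmax : ∀ j ∈ Finset.range (a + k + 1), T j ≤ T k := by
    intro j hj
    have hj' : j ≤ a + k := by simpa [Nat.lt_succ_iff] using hj
    rcases le_total j k with hjk | hjk
    · refine Nat.decreasingInduction' (P := fun i => T i ≤ T k) (fun i hik _ ih => ?_) hjk le_rfl
      refine le_trans ?_ ih
      rcases Nat.eq_zero_or_pos a with rfl | ha
      · simp only [T]
        rw [zero_add, zero_pow (by omega : k - i ≠ 0)]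
        simp
      · have h3 := hsucc i (by omega)
        have h4 : (i + 1) * a ≤ (a + k - i) * k := by
          rw [mul_comm (a + k - i)]
          exact Nat.mul_le_mul hik (by omega)
        have h5 : 0 < (i + 1) * a := by positivity
        nlinarith
    · induction j, hjk using Nat.le_induction with
      | base => exact le_rfl
      | succ i hki ih =>
        refine le_trans ?_ (ih (by simp; omega) (by omega))
        have h3 := hsucc i (by omega)
        have h4 : (a + k - i) * k ≤ (i + 1) * a := by
          rw [mul_comm (i + 1)]
          exact Nat.mul_le_mul (by omega) (by omega)
        have ha : 0 < a := by omega
        have h5 : 0 < (i + 1) * a := by positivity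
        nlinarith
  calc (a + k) ^ (a + k) = (k + a) ^ (a + k) := by rw [add_comm a k]
    _ = ∑ j ∈ Finset.range (a + k + 1), T j := by
        rw [add_pow]; simp [T]
    _ ≤ (a + k + 1) * T k := by
        simpa using Finset.sum_le_card_nsmul _ _ _ hmax
    _ = _ := by
        simp only [T, Nat.add_sub_cancel]; ring

lemma le_log_choose (a k : ℕ) (ha : 0 < a) :
    ((a : ℝ) + k) * Real.log (a + k) - k * Real.log k - a * Real.log a - Real.log (a + k + 1)
      ≤ Real.log ((a + k).choose k) := by
  have hc : (0 : ℝ) < ((a + k).choose k : ℕ) := by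
    exact_mod_cast Nat.choose_pos (by omega)
  have ha' : (0 : ℝ) < a := by exact_mod_cast ha
  have hk : (0 : ℝ) < (k : ℝ) ^ k := by
    rcases Nat.eq_zero_or_pos k with rfl | hk
    · simp
    · positivity
  have h1 : ((a : ℝ) + k) ^ (a + k) ≤ (a + k + 1) * ((a + k).choose k * k ^ k * a ^ a) := by
    exact_mod_cast add_pow_le_mul_choose a k
  have h2 := Real.log_le_log (by positivity) h1
  rw [Real.log_mul (by positivity) (by positivity), Real.log_mul (by positivity) (by positivity),
    Real.log_mul hc.ne' hk.ne', Real.log_pow, Real.log_pow, Real.log_pow] at h2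
  push_cast at h2
  linarith

/-- The entropy rate of the binomial coefficients `(s + ⌊y s⌋).choose ⌊y s⌋`. -/
noncomputable def chooseRate (y : ℝ) : ℝ := (1 + y) * Real.log (1 + y) - y * Real.log y

lemma eventually_le_log_choose {y v : ℝ} (hy : 0 ≤ y) (hv : v < chooseRate y) :
    ∀ᶠ s : ℕ in atTop, s * v ≤ Real.log ((s + ⌊y * s⌋₊).choose ⌊y * s⌋₊) := by
  have hr : Tendsto (fun s : ℕ => (⌊y * s⌋₊ : ℝ) / s) atTop (nhds y) :=
    (tendsto_nat_floor_mul_div_atTop hy).comp tendsto_natCast_atTop_atTop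
  have hinv : Tendsto (fun s : ℕ => (1 : ℝ) / s) atTop (nhds 0) :=
    tendsto_one_div_atTop_nhds_zero_nat
  have hlog : Tendsto (fun s : ℕ => Real.log s / s) atTop (nhds 0) := by
    have := (Real.isLittleO_log_id_atTop.tendsto_div_nhds_zero).comp
      (tendsto_natCast_atTop_atTop (R := ℝ))
    simpa [Function.comp_def] using this
  have hmain : Tendsto (fun s : ℕ => (1 + (⌊y * s⌋₊ : ℝ) / s) * Real.log (1 + (⌊y * s⌋₊ : ℝ) / s)
      - (⌊y * s⌋₊ : ℝ) / s * Real.log ((⌊y * s⌋₊ : ℝ) / s)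
      - Real.log (1 + (⌊y * s⌋₊ : ℝ) / s + 1 / s) * (1 / s) - Real.log s / s) atTop
      (nhds (chooseRate y)) := by
    have h1 : Tendsto (fun s : ℕ => 1 + (⌊y * s⌋₊ : ℝ) / s) atTop (nhds (1 + y)) :=
      hr.const_add 1
    have h2 := (Real.continuous_mul_log.tendsto (1 + y)).comp h1
    have h3 := (Real.continuous_mul_log.tendsto y).comp hr
    have h4 := ((h1.add hinv).log (by positivity)).mul hinv
    have := ((h2.sub h3).sub h4).sub hlog
    simpa [Function.comp_def, chooseRate] using this
  filter_upwards [hmain.eventually (lt_mem_nhds hv), eventually_gt_atTop 0] with s hs hs0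
  refine le_trans ?_ (le_log_choose s ⌊y * s⌋₊ hs0)
  have hs' : (0 : ℝ) < s := by exact_mod_cast hs0
  set N : ℝ := (⌊y * s⌋₊ : ℝ) with hN
  have hN0 : 0 ≤ N := Nat.cast_nonneg _
  have e1 : Real.log (s + N) = Real.log s + Real.log (1 + N / s) := by
    rw [← Real.log_mul hs'.ne' (by positivity)]
    congr 1; field_simp
  have e2 : Real.log (s + N + 1) = Real.log s + Real.log (1 + N / s + 1 / s) := by
    rw [← Real.log_mul hs'.ne' (by positivity)]
    congr 1; field_simp
  have e3 : N * Real.log (N / s) = N * Real.log N - N * Real.log s := by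
    rcases hN0.eq_or_lt with h0 | h0
    · simp [← h0]
    · rw [Real.log_div h0.ne' hs'.ne']; ring
  rw [e1, e2]
  have := mul_le_mul_of_nonneg_left hs.le hs'.le
  refine this.trans (le_of_eq ?_)
  field_simp
  linear_combination (-1 : ℝ) * e3

lemma exists_lt_mul_sum_neg_log {c Z : ℝ} (hZ : HasSum (fun k : ℕ => 1 / ((k : ℝ) + 1) ^ 2) Z)
    (hc : c < Z) : ∃ δ : ℝ, 0 < δ ∧ ∃ J : ℕ,
      c < δ * ∑ j : Fin J, -Real.log (1 - Real.exp (-δ) ^ ((j : ℕ) + 1)) := by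
  obtain ⟨K, hK⟩ := (hZ.tendsto_sum_nat.eventually (lt_mem_nhds hc)).exists
  have hcont : Continuous fun δ : ℝ =>
      ∑ k ∈ Finset.range K, Real.exp (-δ) ^ (k + 1) / ((k : ℝ) + 1) ^ 2 := by fun_prop
  have hev : ∀ᶠ δ : ℝ in nhds 0,
      c < ∑ k ∈ Finset.range K, Real.exp (-δ) ^ (k + 1) / ((k : ℝ) + 1) ^ 2 := by
    refine (hcont.tendsto 0).eventually (lt_mem_nhds ?_)
    simpa using hK
  obtain ⟨δ, hδ, hδ0⟩ := ((hev.filter_mono nhdsWithin_le_nhds).and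
    (self_mem_nhdsWithin : Set.Ioi (0 : ℝ) ∈ nhdsWithin 0 (Set.Ioi 0))).exists
  have hδ0 : 0 < δ := hδ0
  refine ⟨δ, hδ0, ?_⟩
  set x := Real.exp (-δ) with hx
  have hx0 : 0 < x := Real.exp_pos _
  have hx1 : x < 1 := Real.exp_zero ▸ Real.exp_lt_exp.2 (by linarith)
  have hpow : ∀ n : ℕ, x ^ (n + 1) < 1 := fun n => pow_lt_one₀ hx0.le hx1 (by omega)
  have hlim : Tendsto (fun J : ℕ => δ * ∑ k ∈ Finset.range K,
      (∑ j ∈ Finset.range J, (x ^ (k + 1)) ^ j) * (x ^ (k + 1) / ((k : ℝ) + 1))) atTop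
      (nhds (δ * ∑ k ∈ Finset.range K, (1 - x ^ (k + 1))⁻¹ * (x ^ (k + 1) / ((k : ℝ) + 1)))) :=
    (tendsto_finsetSum _ fun k _ => (hasSum_geometric_of_lt_one (by positivity)
      (hpow k)).tendsto_sum_nat.mul_const _).const_mul δ
  have hlt : c < δ * ∑ k ∈ Finset.range K,
      (1 - x ^ (k + 1))⁻¹ * (x ^ (k + 1) / ((k : ℝ) + 1)) := by
    refine hδ.trans_le ?_
    rw [Finset.mul_sum]
    refine Finset.sum_le_sum fun k _ => ?_
    have h1 : 1 - x ^ (k + 1) ≤ ((k : ℝ) + 1) * δ := by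
      have := Real.add_one_le_exp (-(((k : ℝ) + 1) * δ))
      have he : x ^ (k + 1) = Real.exp (-(((k : ℝ) + 1) * δ)) := by
        rw [hx, ← Real.exp_nat_mul]; congr 1; push_cast; ring
      linarith
    have h0 : 0 < 1 - x ^ (k + 1) := sub_pos.2 (hpow k)
    have h2 : 1 / ((k : ℝ) + 1) ≤ δ * (1 - x ^ (k + 1))⁻¹ := by
      rw [← div_eq_mul_inv, div_le_div_iff₀ (by positivity) h0]
      linarith
    calc x ^ (k + 1) / ((k : ℝ) + 1) ^ 2
        = 1 / ((k : ℝ) + 1) * (x ^ (k + 1) / ((k : ℝ) + 1)) := by field_simp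
      _ ≤ δ * (1 - x ^ (k + 1))⁻¹ * (x ^ (k + 1) / ((k : ℝ) + 1)) := by gcongr
      _ = _ := by ring
  obtain ⟨J, hJ⟩ := (hlim.eventually (lt_mem_nhds hlt)).exists
  refine ⟨J, hJ.trans_le ?_⟩
  refine mul_le_mul_of_nonneg_left ?_ hδ0.le
  rw [Fin.sum_univ_eq_sum_range (fun j => -Real.log (1 - x ^ (j + 1)))]
  simp only [Finset.sum_mul]
  rw [Finset.sum_comm]
  refine Finset.sum_le_sum fun j _ => ?_
  refine le_trans (le_of_eq ?_) (sum_le_hasSum (Finset.range K) (fun _ _ => by positivity)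
    (Real.hasSum_pow_div_log_of_abs_lt_one (x := x ^ (j + 1)) ?_))
  · refine Finset.sum_congr rfl fun k _ => ?_
    rw [← mul_div_assoc]
    congr 1
    ring
  · rw [abs_of_pos (by positivity)]
    exact hpow j

lemma chooseRate_div_one_sub {x : ℝ} (hx0 : 0 < x) (hx1 : x < 1) :
    chooseRate (x / (1 - x)) = -Real.log (1 - x) - x / (1 - x) * Real.log x := by
  have h0 : 0 < 1 - x := sub_pos.2 hx1
  have e : 1 + x / (1 - x) = (1 - x)⁻¹ := by field_simp; ring
  rw [chooseRate, e, Real.log_inv, Real.log_div hx0.ne' h0.ne']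
  field_simp
  ring

lemma exists_lower_bound_Lbox {ρ Z : ℝ} (hZ : HasSum (fun k : ℕ => 1 / ((k : ℝ) + 1) ^ 2) Z)
    (hρ0 : 0 < ρ) (hρ : ρ < 2 * √Z) : ∃ A : ℝ, ∀ᶠ h : ℕ in atTop, ∃ b : ℕ,
      (b : ℝ) ≤ A * √(h : ℝ) ∧ ∀ n w : ℕ, n + b ≤ w → n * (ρ * √(h : ℝ)) ≤ Lbox h w := by
  have hZ' : (ρ / 2) ^ 2 < Z := by
    rw [← Real.lt_sqrt (by positivity)]; linarith
  obtain ⟨δ, hδ, J, hJ⟩ := exists_lt_mul_sum_neg_log hZ hZ'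
  set x := Real.exp (-δ) with hx
  have hx0 : 0 < x := Real.exp_pos _
  have hx1 : x < 1 := Real.exp_zero ▸ Real.exp_lt_exp.2 (by linarith)
  have hpow : ∀ n : ℕ, x ^ (n + 1) < 1 := fun n => pow_lt_one₀ hx0.le hx1 (by omega)
  set F := ∑ j : Fin J, -Real.log (1 - x ^ ((j : ℕ) + 1)) with hF
  have hJ0 : 0 < J := by
    rcases Nat.eq_zero_or_pos J with rfl | h
    · simp [hF] at hJ
      nlinarith [sq_nonneg (ρ / 2)]
    · exact h
  let y : Fin J → ℝ := fun j => x ^ ((j : ℕ) + 1) / (1 - x ^ ((j : ℕ) + 1))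
  have hy : ∀ j, 0 < y j := fun j => div_pos (by positivity) (sub_pos.2 (hpow j))
  set S := ∑ j : Fin J, y j * ((j : ℕ) + 1) with hS
  have hS0 : 0 < S :=
    Finset.sum_pos (fun j _ => mul_pos (hy j) (by positivity)) ⟨⟨0, hJ0⟩, Finset.mem_univ _⟩
  have hsS : 0 < √S := Real.sqrt_pos.2 hS0
  have hV : ∑ j, chooseRate (y j) = F + δ * S := by
    rw [hF, hS, Finset.mul_sum, ← Finset.sum_add_distrib]
    refine Finset.sum_congr rfl fun j _ => ?_
    rw [chooseRate_div_one_sub (by positivity) (hpow j), Real.log_pow, hx, Real.log_exp, ← hx]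
    push_cast
    simp only [y]
    ring
  have hF0 : 0 < F := by
    by_contra hF0
    nlinarith [sq_nonneg (ρ / 2)]
  have hVlt : ρ * √S < F + δ * S := by
    refine lt_of_pow_lt_pow_left₀ 2 (by positivity) ?_
    rw [mul_pow, Real.sq_sqrt hS0.le]
    nlinarith [sq_nonneg (F - δ * S)]
  set η := (F + δ * S - ρ * √S) / (2 * J) with hη
  have hJr : (0 : ℝ) < J := by exact_mod_cast hJ0
  have hη0 : 0 < η := div_pos (by linarith) (by positivity)
  set V := F + δ * S - J * η with hVdef
  have hVlt' : ρ * √S < V := by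
    have : J * η = (F + δ * S - ρ * √S) / 2 := by rw [hη]; field_simp
    linarith
  have hsum : ∀ᶠ s : ℕ in atTop,
      s * V ≤ Real.log (∏ j, (s + ⌊y j * s⌋₊).choose ⌊y j * s⌋₊ : ℕ) := by
    have : ∀ᶠ s : ℕ in atTop, ∀ j : Fin J, s * (chooseRate (y j) - η)
        ≤ Real.log ((s + ⌊y j * s⌋₊).choose ⌊y j * s⌋₊) :=
      eventually_all.2 fun j => eventually_le_log_choose (hy j).le (by linarith)
    filter_upwards [this] with s hs
    rw [Nat.cast_prod, Real.log_prod fun j _ => by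
      exact_mod_cast (Nat.choose_pos (Nat.le_add_left _ _)).ne']
    refine le_trans (le_of_eq ?_) (Finset.sum_le_sum fun j _ => hs j)
    rw [← Finset.mul_sum, Finset.sum_sub_distrib, hV]
    simp [hVdef]
  have hsqrt : Tendsto (fun h : ℕ => √(h : ℝ)) atTop atTop :=
    Real.tendsto_sqrt_atTop.comp tendsto_natCast_atTop_atTop
  have hfl : Tendsto (fun h : ℕ => ⌊√(h : ℝ) / √S⌋₊ - 2) atTop atTop :=
    (tendsto_sub_atTop_nat 2).comp
      (tendsto_nat_floor_atTop.comp (hsqrt.atTop_div_const hsS))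
  have hgap : 0 < V / √S - ρ := by
    rw [sub_pos, lt_div_iff₀ hsS]; exact hVlt'
  have hV0 : 0 < V := lt_trans (by positivity) hVlt'
  refine ⟨J / √S, ?_⟩
  filter_upwards [hfl.eventually hsum, hfl.eventually_ge_atTop 1,
    (hsqrt.atTop_mul_const hgap).eventually_ge_atTop (3 * V)] with h hs hs1 hbig
  set q := √(h : ℝ) / √S with hq
  have hq0 : 0 ≤ q := by positivity
  set s := ⌊q⌋₊ - 2 with hsdef
  have hs2 : s + 2 = ⌊q⌋₊ := by omega
  have hsle : (s : ℝ) + 2 ≤ q := by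
    have := Nat.floor_le hq0
    rw [← hs2] at this
    exact_mod_cast this
  have hsge : q < (s : ℝ) + 3 := by
    have := Nat.lt_floor_add_one q
    rw [← hs2] at this
    push_cast at this
    linarith
  have hqS : q ^ 2 * S = h := by
    rw [hq, div_pow, Real.sq_sqrt hS0.le, Real.sq_sqrt (Nat.cast_nonneg h)]
    field_simp
  refine ⟨J * (s + 1), ?_, fun n w hnw => ?_⟩
  · have e : (J : ℝ) / √S * √(h : ℝ) = J * q := by rw [hq]; ring
    rw [e]
    push_cast
    exact mul_le_mul_of_nonneg_left (by linarith) hJr.le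
  · have hN : ∑ j : Fin J, ⌊y j * s⌋₊ * ((j + 1) * (s + 2)) ≤ h := by
      have : ((∑ j : Fin J, ⌊y j * s⌋₊ * (((j : ℕ) + 1) * (s + 2)) : ℕ) : ℝ) ≤ h := by
        rw [← hqS, hS, Finset.mul_sum]
        push_cast
        refine Finset.sum_le_sum fun j _ => ?_
        have h1 : (⌊y j * s⌋₊ : ℝ) ≤ y j * s := Nat.floor_le (mul_nonneg (hy j).le (by positivity))
        have h2 : (s : ℝ) * (s + 2) ≤ q ^ 2 := by
          have : (0 : ℝ) ≤ s := Nat.cast_nonneg s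
          nlinarith
        calc (⌊y j * s⌋₊ : ℝ) * (((j : ℕ) + 1) * (s + 2))
            ≤ y j * s * (((j : ℕ) + 1) * (s + 2)) := by gcongr
          _ = (s * (s + 2)) * (y j * ((j : ℕ) + 1)) := by ring
          _ ≤ q ^ 2 * (y j * ((j : ℕ) + 1)) :=
            mul_le_mul_of_nonneg_right h2 (mul_nonneg (hy j).le (by positivity))
      exact_mod_cast this
    have hK := prod_choose_pow_le_KPF J s h (fun j => ⌊y j * s⌋₊) hN hnw
    have hP : 0 < ∏ j : Fin J, (s + ⌊y j * s⌋₊).choose ⌊y j * s⌋₊ :=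
      Finset.prod_pos fun j _ => Nat.choose_pos (Nat.le_add_left _ _)
    have hlog : n * Real.log (∏ j : Fin J, (s + ⌊y j * s⌋₊).choose ⌊y j * s⌋₊ : ℕ)
        ≤ Lbox h w := by
      rw [← Real.log_pow]
      exact Real.log_le_log (by positivity) (by exact_mod_cast hK)
    refine le_trans (mul_le_mul_of_nonneg_left (le_trans ?_ hs) (Nat.cast_nonneg n)) hlog
    have e : √(h : ℝ) * (V / √S - ρ) = q * V - ρ * √(h : ℝ) := by rw [hq]; ring
    nlinarith

/-- There is a universal constant `γ₊ > 0` such that whenever `√h ≻ 1` and `w ≻ √h`,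
`L[h,w] ∼ γ₊·w·√h`. -/
theorem Lbox_asymp_wide :
    ∃ γ : ℝ, 0 < γ ∧ ∀ h w : ℕ → ℕ,
      (∀ n, 0 < h n) → (∀ n, 0 < w n) →
      Tendsto (fun n => (1 : ℝ) / Real.sqrt (h n : ℝ)) atTop (nhds 0) →
      Tendsto (fun n => Real.sqrt (h n : ℝ) / (w n : ℝ)) atTop (nhds 0) →
      Tendsto (fun n =>
          Lbox (h n) (w n) / (γ * (w n : ℝ) * Real.sqrt (h n : ℝ)))
        atTop (nhds 1) := by
  have hsm : Summable fun k : ℕ => 1 / ((k : ℝ) + 1) ^ 2 := by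
    have := (summable_nat_add_iff 1).2 (Real.summable_one_div_nat_pow.2 (one_lt_two))
    simpa using this
  obtain ⟨Z, hZ⟩ := hsm
  have hZ0 : 0 < Z := by
    have := sum_le_hasSum {0} (fun _ _ => by positivity) hZ
    simp at this
    linarith
  have hγ : 0 < 2 * √Z := by positivity
  refine ⟨2 * √Z, hγ, fun h w hh hw hlim hrat => ?_⟩
  have hsh : ∀ n, 0 < √(h n : ℝ) := fun n => Real.sqrt_pos.2 (by exact_mod_cast hh n)
  have hwr : ∀ n, (0 : ℝ) < w n := fun n => by exact_mod_cast hw n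
  have hden : ∀ n, 0 < 2 * √Z * (w n : ℝ) * √(h n : ℝ) := fun n =>
    mul_pos (mul_pos hγ (hwr n)) (hsh n)
  refine tendsto_order.2 ⟨fun a ha => ?_, fun a ha => Eventually.of_forall fun n => ?_⟩
  · set r := (1 + max a 0) / 2 with hr
    have ha0 : max a 0 < 1 := max_lt ha one_pos
    have hr0 : 0 < r := by have := le_max_right a 0; positivity
    have hr1 : r < 1 := by linarith
    have har : a < r := by have := le_max_left a 0; linarith
    obtain ⟨A, hA⟩ := exists_lower_bound_Lbox hZ (ρ := r * (2 * √Z)) (by positivity)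
      (by nlinarith)
    have hhtop : Tendsto h atTop atTop := by
      have h1 : Tendsto (fun n => √(h n : ℝ)) atTop atTop := by
        have : Tendsto (fun n => (1 : ℝ) / √(h n : ℝ)) atTop (nhdsWithin 0 (Set.Ioi 0)) :=
          tendsto_nhdsWithin_iff.2 ⟨hlim, Eventually.of_forall fun n => one_div_pos.2 (hsh n)⟩
        simpa [Function.comp_def] using tendsto_inv_nhdsGT_zero.comp this
      refine (tendsto_natCast_atTop_iff (R := ℝ)).1 (tendsto_atTop_mono' _ ?_ h1)
      refine Eventually.of_forall fun n => ?_
      have h1 : (1 : ℝ) ≤ h n := by exact_mod_cast hh n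
      rw [Real.sqrt_le_left (by linarith)]
      nlinarith
    have hcoef : Tendsto (fun n => r * (1 - A * (√(h n : ℝ) / (w n : ℝ)))) atTop (nhds r) := by
      simpa using ((hrat.const_mul A).const_sub 1).const_mul r
    have hcoef' : Tendsto (fun n => A * (√(h n : ℝ) / (w n : ℝ))) atTop (nhds 0) := by
      simpa using hrat.const_mul A
    filter_upwards [hhtop.eventually hA, hcoef.eventually (lt_mem_nhds har),
      hcoef'.eventually (gt_mem_nhds one_pos)] with n hn h1 h2
    obtain ⟨b, hb, hL⟩ := hn
    have e : A * (√(h n : ℝ) / (w n : ℝ)) * w n = A * √(h n : ℝ) := by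
      have := (hwr n).ne'
      field_simp
    have hbw : b ≤ w n := by
      have : (b : ℝ) ≤ w n := by nlinarith [hwr n]
      exact_mod_cast this
    have h3 := hL (w n - b) (w n) (by omega)
    rw [Nat.cast_sub hbw] at h3
    refine h1.trans_le ((le_div_iff₀ (hden n)).2 (le_trans ?_ h3))
    have h4 : (w n : ℝ) - A * √(h n : ℝ) ≤ w n - b := by linarith
    calc r * (1 - A * (√(h n : ℝ) / (w n : ℝ))) * (2 * √Z * (w n : ℝ) * √(h n : ℝ))
        = ((w n : ℝ) - A * (√(h n : ℝ) / (w n : ℝ)) * w n) * (r * (2 * √Z) * √(h n : ℝ)) := by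
          ring
      _ = ((w n : ℝ) - A * √(h n : ℝ)) * (r * (2 * √Z) * √(h n : ℝ)) := by rw [e]
      _ ≤ _ := mul_le_mul_of_nonneg_right h4 (mul_nonneg (by positivity) (hsh n).le)
  · refine lt_of_le_of_lt ((div_le_one (hden n)).2 ?_) ha
    exact Lbox_le hZ0 hZ (hh n) (w n)
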